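/- For every pair of real numbers y < x there exist θ₁, θ₂ ∈ (y, x) such that (1/(F(x) − F(y))) · (−y/2 − (F'(x) − F'(y))/(F(x) − F(y))) = 1/(4F'(θ₁)) and (1/(F(x) − F(y))) · (x/2 + (F'(x) − F'(y))/(F(x) − F(y))) = 1/(4F'(θ₂)). -/

import Mathlib

open Real Filter Finset

/-- The rescaled Gaussian cumulative distribution function
`F(ξ) = (1/(2√π)) ∫_{-∞}^{ξ} e^{-s²/4} ds`. -/
noncomputable def F (x : ℝ) : ℝ :=
  (1 / (2 * Real.sqrt Real.pi)) * ∫ s in Set.Iio x, Real.exp (-s ^ 2 / 4)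

/-- The derivative `F'(ξ) = (1/(2√π)) e^{-ξ²/4}`. -/
noncomputable def F' (x : ℝ) : ℝ :=
  (1 / (2 * Real.sqrt Real.pi)) * Real.exp (-x ^ 2 / 4)

theorem integrable_exp_neg_sq_div_four :
    MeasureTheory.Integrable fun s : ℝ => Real.exp (-s ^ 2 / 4) := by
  have h := integrable_exp_neg_mul_sq (b := 1 / 4) (by norm_num)
  refine h.congr (Filter.Eventually.of_forall fun s => ?_)
  simp only
  congr 1
  ring

theorem hasDerivAt_F (x : ℝ) : HasDerivAt F (F' x) x := by
  have hF : F = fun u => F 0 +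
      (1 / (2 * Real.sqrt Real.pi)) * ∫ s in (0 : ℝ)..u, Real.exp (-s ^ 2 / 4) := by
    funext u
    rw [← intervalIntegral.integral_Iic_sub_Iic
      integrable_exp_neg_sq_div_four.integrableOn integrable_exp_neg_sq_div_four.integrableOn]
    simp only [F, MeasureTheory.integral_Iic_eq_integral_Iio]
    ring
  have hc : Continuous fun s : ℝ => Real.exp (-s ^ 2 / 4) := by fun_prop
  rw [hF]
  exact ((hc.integral_hasStrictDerivAt 0 x).hasDerivAt.const_mul _).const_add _

theorem hasDerivAt_F' (x : ℝ) : HasDerivAt F' (-x / 2 * F' x) x := by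
  have h : HasDerivAt (fun u : ℝ => -u ^ 2 / 4) (-x / 2) x := by
    refine ((hasDerivAt_pow 2 x).fun_neg.div_const 4).congr_deriv ?_
    norm_num
    ring
  refine (h.exp.const_mul (1 / (2 * Real.sqrt Real.pi))).congr_deriv ?_
  unfold F'
  ring

theorem F'_pos (x : ℝ) : 0 < F' x := by
  unfold F'
  positivity

theorem strictMono_F : StrictMono F :=
  strictMono_of_hasDerivAt_pos hasDerivAt_F F'_pos

theorem exists_F_sub_eq_mul {y x a b : ℝ} (ha : a ∈ Set.Icc y x) (hb : b ∈ Set.Icc y x)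
    (hab : a ≠ b) : ∃ θ ∈ Set.Ioo y x, F b - F a = F' θ * (b - a) := by
  have key : ∀ {u v : ℝ}, u ∈ Set.Icc y x → v ∈ Set.Icc y x → u < v →
      ∃ θ ∈ Set.Ioo y x, F v - F u = F' θ * (v - u) := by
    intro u v hu hv huv
    obtain ⟨θ, hθ, h⟩ := exists_hasDerivAt_eq_slope F F' huv
      (fun z _ => (hasDerivAt_F z).continuousAt.continuousWithinAt) (fun z _ => hasDerivAt_F z)
    refine ⟨θ, ⟨hu.1.trans_lt hθ.1, hθ.2.trans_le hv.2⟩, ?_⟩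
    rw [h, div_mul_cancel₀ _ (sub_ne_zero.2 huv.ne')]
  rcases hab.lt_or_gt with h | h
  · exact key ha hb h
  · obtain ⟨θ, hθ, e⟩ := key hb ha h
    exact ⟨θ, hθ, by linarith⟩

/-- Cauchy's mean value theorem for `-c / 2 * F - F'` and `(F - F c) ^ 2`, where `c` is an
endpoint of the interval. -/
theorem exists_sq_sub_sq_eq_mul {x y c : ℝ} (hyx : y < x) (hc : c ∈ Set.Icc y x)
    (hc' : c ∉ Set.Ioo y x) : ∃ θ ∈ Set.Ioo y x,
      (F x - F c) ^ 2 - (F y - F c) ^ 2 =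
        4 * F' θ * (-c / 2 * (F x - F y) - (F' x - F' y)) := by
  have hf : ∀ t, HasDerivAt (fun u => -c / 2 * F u - F' u) (F' t * (t - c) / 2) t := by
    intro t
    refine (((hasDerivAt_F t).const_mul (-c / 2)).fun_sub (hasDerivAt_F' t)).congr_deriv ?_
    ring
  have hg : ∀ t, HasDerivAt (fun u => (F u - F c) ^ 2) (2 * (F t - F c) * F' t) t := by
    intro t
    refine (((hasDerivAt_F t).sub_const (F c)).fun_pow 2).congr_deriv ?_
    simp
  obtain ⟨t, ht, h⟩ := exists_ratio_hasDerivAt_eq_ratio_slope _ _ hyx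
    (fun z _ => (hf z).continuousAt.continuousWithinAt) (fun z _ => hf z) _ _
    (fun z _ => (hg z).continuousAt.continuousWithinAt) (fun z _ => hg z)
  have hct : c ≠ t := fun e => hc' (e ▸ ht)
  obtain ⟨θ, hθ, e⟩ := exists_F_sub_eq_mul hc (Set.Ioo_subset_Icc_self ht) hct
  refine ⟨θ, hθ, ?_⟩
  rw [e] at h
  have hne : F' t * (t - c) ≠ 0 := mul_ne_zero (F'_pos t).ne' (sub_ne_zero.2 hct.symm)
  apply mul_right_cancel₀ hne
  linear_combination 2 * h

/-- Lemma 2: for each `y < x` there exist `θ₁, θ₂ ∈ (y, x)` such that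
`(1/(F(x) − F(y))) (−y/2 − (F'(x) − F'(y))/(F(x) − F(y))) = 1/(4F'(θ₁))` and
`(1/(F(x) − F(y))) (x/2 + (F'(x) − F'(y))/(F(x) − F(y))) = 1/(4F'(θ₂))`. -/
theorem stmt10 (x y : ℝ) (hyx : y < x) :
    ∃ θ₁ ∈ Set.Ioo y x, ∃ θ₂ ∈ Set.Ioo y x,
      (1 / (F x - F y)) * (-y / 2 - (F' x - F' y) / (F x - F y)) = 1 / (4 * F' θ₁) ∧
      (1 / (F x - F y)) * (x / 2 + (F' x - F' y) / (F x - F y)) = 1 / (4 * F' θ₂) := by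
  have hD : F x - F y ≠ 0 := (sub_pos.2 (strictMono_F hyx)).ne'
  obtain ⟨θ₁, h₁, e₁⟩ := exists_sq_sub_sq_eq_mul hyx (Set.left_mem_Icc.2 hyx.le) (by simp)
  obtain ⟨θ₂, h₂, e₂⟩ := exists_sq_sub_sq_eq_mul hyx (Set.right_mem_Icc.2 hyx.le) (by simp)
  have p₁ := (F'_pos θ₁).ne'
  have p₂ := (F'_pos θ₂).ne'
  refine ⟨θ₁, h₁, θ₂, h₂, ?_, ?_⟩
  · have : (1 / (F x - F y)) * (-y / 2 - (F' x - F' y) / (F x - F y)) =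
        (-y / 2 * (F x - F y) - (F' x - F' y)) / (F x - F y) ^ 2 := by
      field_simp
    rw [this, div_eq_div_iff (pow_ne_zero 2 hD) (mul_ne_zero four_ne_zero p₁)]
    linear_combination -e₁
  · have : (1 / (F x - F y)) * (x / 2 + (F' x - F' y) / (F x - F y)) =
        (x / 2 * (F x - F y) + (F' x - F' y)) / (F x - F y) ^ 2 := by
      field_simp
    rw [this, div_eq_div_iff (pow_ne_zero 2 hD) (mul_ne_zero four_ne_zero p₂)]
    linear_combination e₂
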